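/- Under the stated assumptions, suppose for each k ∈ K that Z_k > 0 almost surely and Z_k and log(1 + |μ† h_k|² E_k / Z_k) are integrable. Then the mean spectral efficiency satisfies E[ (1/|K|) Σ_{k∈K} log(1 + |μ† h_k|² E_k / Z_k) ] ≥ (1/|K|) Σ_{k∈K} log( 1 + M_rx E^{(r)} e^{−v} |β(f_c, f_k)|² E_k / ( β(0,0) (N_0/D_2) E_k + β(0,0) (N_0 T_cs/T_s) E^{(r)} e^{−v} + N_0² T_cs/(D_2 T_s) ) ). -/

import Mathlib

open Real Finset MeasureTheory ProbabilityTheory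

/-- The conjugate inner product `u† v = Σ_i conj(u_i) v_i`. -/
noncomputable def dotc {M : ℕ} (u v : Fin M → ℂ) : ℂ :=
  ∑ i, (starRingEnd ℂ) (u i) * v i

/-- The frequency-domain channel matrix `Σ_ℓ α_ℓ a_rx(ℓ) a_tx(ℓ)† e^{−2πi f τ_ℓ}`. -/
noncomputable def chanMat {L Mtx Mrx : ℕ} (α : Fin L → ℂ)
    (arx : Fin L → Fin Mrx → ℂ) (atx : Fin L → Fin Mtx → ℂ)
    (τ : Fin L → ℝ) (f : ℝ) : Matrix (Fin Mrx) (Fin Mtx) ℂ :=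
  ∑ ℓ, (α ℓ * Complex.exp (((-(2 * π * f * τ ℓ)) : ℝ) * Complex.I)) •
    Matrix.vecMulVec (arx ℓ) (star (atx ℓ))

/-- The frequency-selective coupling coefficient
`β(ḟ, f̈) = Σ_ℓ |α_ℓ|² |a_tx(ℓ)† t|² e^{i(2π ḟ (τ̂_ℓ − τ_ℓ) − 2π f̈ τ_ℓ)}`. -/
noncomputable def betaCoef {L Mtx : ℕ} (α : Fin L → ℂ) (atx : Fin L → Fin Mtx → ℂ)
    (τhat τ : Fin L → ℝ) (t : Fin Mtx → ℂ) (fdot fddot : ℝ) : ℂ :=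
  ∑ ℓ, ((‖α ℓ‖ ^ 2 * ‖dotc (atx ℓ) t‖ ^ 2 : ℝ) : ℂ) *
    Complex.exp (((2 * π * fdot * (τhat ℓ - τ ℓ) - 2 * π * fddot * τ ℓ) : ℝ) * Complex.I)

/-- `β(0,0) = Σ_ℓ |α_ℓ|² |a_tx(ℓ)† t|²`. -/
noncomputable def betaZero {L Mtx : ℕ} (α : Fin L → ℂ) (atx : Fin L → Fin Mtx → ℂ)
    (t : Fin Mtx → ℂ) : ℝ :=
  ∑ ℓ, ‖α ℓ‖ ^ 2 * ‖dotc (atx ℓ) t‖ ^ 2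

theorem dotc_self {M : ℕ} (u : Fin M → ℂ) :
    dotc u u = ((∑ i, ‖u i‖ ^ 2 : ℝ) : ℂ) := by
  simp [dotc, Complex.conj_mul']

theorem dotc_const_mul_left {M : ℕ} (c : ℂ) (u v : Fin M → ℂ) :
    dotc (fun i => c * u i) v = (starRingEnd ℂ) c * dotc u v := by
  simp [dotc, Finset.mul_sum, mul_assoc]

/-- The inner product of two combinations of orthogonal vectors of equal norm. -/
theorem dotc_sum_of_orthogonal {L M : ℕ} {a : Fin L → Fin M → ℂ} {r : ℂ}
    (horth : ∀ ℓ m, ℓ ≠ m → dotc (a ℓ) (a m) = 0) (hnorm : ∀ ℓ, dotc (a ℓ) (a ℓ) = r)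
    (c d : Fin L → ℂ) :
    dotc (fun i => ∑ ℓ, c ℓ * a ℓ i) (fun i => ∑ ℓ, d ℓ * a ℓ i)
      = r * ∑ ℓ, (starRingEnd ℂ) (c ℓ) * d ℓ := by
  have expand : dotc (fun i => ∑ ℓ, c ℓ * a ℓ i) (fun i => ∑ ℓ, d ℓ * a ℓ i)
      = ∑ ℓ, ∑ m, (starRingEnd ℂ) (c ℓ) * d m * dotc (a ℓ) (a m) := by
    simp only [dotc, map_sum, map_mul, Finset.sum_mul_sum]
    rw [Finset.sum_comm]
    refine Finset.sum_congr rfl fun ℓ _ => ?_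
    rw [Finset.sum_comm]
    refine Finset.sum_congr rfl fun m _ => ?_
    rw [Finset.mul_sum]
    refine Finset.sum_congr rfl fun i _ => ?_
    ring
  rw [expand, Finset.mul_sum]
  refine Finset.sum_congr rfl fun ℓ _ => ?_
  rw [Finset.sum_eq_single ℓ (fun m _ hm => by rw [horth ℓ m hm.symm, mul_zero])
    (fun h => absurd (Finset.mem_univ ℓ) h), hnorm]
  ring

theorem chanMat_mulVec {L Mtx Mrx : ℕ} (α : Fin L → ℂ)
    (arx : Fin L → Fin Mrx → ℂ) (atx : Fin L → Fin Mtx → ℂ)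
    (τ : Fin L → ℝ) (f : ℝ) (t : Fin Mtx → ℂ) :
    (chanMat α arx atx τ f).mulVec t = fun i => ∑ ℓ,
      (α ℓ * Complex.exp (((-(2 * π * f * τ ℓ)) : ℝ) * Complex.I) * dotc (atx ℓ) t)
        * arx ℓ i := by
  funext i
  simp only [chanMat, Matrix.sum_mulVec, Finset.sum_apply, Matrix.smul_mulVec, Pi.smul_apply,
    smul_eq_mul]
  refine Finset.sum_congr rfl fun ℓ _ => ?_
  simp only [Matrix.mulVec, dotProduct, Matrix.vecMulVec_apply, dotc, Pi.star_apply,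
    RCLike.star_def, Finset.mul_sum, Finset.sum_mul]
  refine Finset.sum_congr rfl fun j _ => ?_
  ring

section Channel

variable {L Mtx Mrx : ℕ} {α : Fin L → ℂ} {arx : Fin L → Fin Mrx → ℂ}
  {atx : Fin L → Fin Mtx → ℂ}

theorem dotc_chanMat_mulVec (horth : ∀ ℓ m, ℓ ≠ m → dotc (arx ℓ) (arx m) = 0)
    (hnorm : ∀ ℓ, dotc (arx ℓ) (arx ℓ) = (Mrx : ℂ))
    (τhat τ : Fin L → ℝ) (t : Fin Mtx → ℂ) (f g : ℝ) :
    dotc ((chanMat α arx atx τhat f).mulVec t) ((chanMat α arx atx τ (f + g)).mulVec t)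
      = Mrx * betaCoef α atx τhat τ t f g := by
  rw [chanMat_mulVec, chanMat_mulVec, dotc_sum_of_orthogonal horth hnorm, betaCoef]
  congr 1
  refine Finset.sum_congr rfl fun ℓ _ => ?_
  have hexp : Complex.exp (((2 * π * f * (τhat ℓ - τ ℓ) - 2 * π * g * τ ℓ) : ℝ) * Complex.I)
      = Complex.exp (-((-(2 * π * f * τhat ℓ) : ℝ) * Complex.I))
        * Complex.exp (((-(2 * π * (f + g) * τ ℓ)) : ℝ) * Complex.I) := by
    rw [← Complex.exp_add]
    congr 1
    push_cast
    ring
  rw [hexp]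
  simp only [map_mul, ← Complex.exp_conj, Complex.conj_ofReal, Complex.conj_I, mul_neg]
  push_cast
  rw [← Complex.conj_mul' (α ℓ), ← Complex.conj_mul' (dotc (atx ℓ) t)]
  ring

theorem sum_norm_sq_chanMat_mulVec (horth : ∀ ℓ m, ℓ ≠ m → dotc (arx ℓ) (arx m) = 0)
    (hnorm : ∀ ℓ, dotc (arx ℓ) (arx ℓ) = (Mrx : ℂ))
    (τ : Fin L → ℝ) (t : Fin Mtx → ℂ) (f : ℝ) :
    ∑ i, ‖(chanMat α arx atx τ f).mulVec t i‖ ^ 2 = Mrx * betaZero α atx t := by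
  have h := dotc_chanMat_mulVec (α := α) (atx := atx) horth hnorm τ τ t f 0
  rw [add_zero, dotc_self] at h
  have hβ : betaCoef α atx τ τ t f 0 = (betaZero α atx t : ℂ) := by
    simp [betaCoef, betaZero]
  rw [hβ] at h
  exact_mod_cast h

end Channel

section Noise

variable {Ω : Type*} [MeasurableSpace Ω] {P : Measure Ω} {M : ℕ} {W : Ω → Fin M → ℂ} {s : ℝ}

theorem integrable_mul_conj (hL2 : ∀ m, MemLp (fun ω => W ω m) 2 P) (m n : Fin M) :
    Integrable (fun ω => W ω m * (starRingEnd ℂ) (W ω n)) P :=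
  (hL2 m).integrable_mul (hL2 n).star

theorem integral_norm_sq (hcov : ∀ m n, (∫ ω, W ω m * (starRingEnd ℂ) (W ω n) ∂P)
      = if m = n then (s : ℂ) else 0) (m : Fin M) :
    ∫ ω, ‖W ω m‖ ^ 2 ∂P = s := by
  have h := hcov m m
  simp only [Complex.mul_conj', if_true] at h
  have h' : ((∫ ω, ‖W ω m‖ ^ 2 ∂P : ℝ) : ℂ) = s := by
    rw [← h, ← integral_complex_ofReal]
    push_cast
    rfl
  exact_mod_cast h'

theorem integrable_norm_add_sq [IsFiniteMeasure P] (hL2 : ∀ m, MemLp (fun ω => W ω m) 2 P)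
    (c : ℂ) (m : Fin M) : Integrable (fun ω => ‖c + W ω m‖ ^ 2) P :=
  ((memLp_const c).add (hL2 m)).integrable_norm_pow (by norm_num)

theorem integral_norm_add_sq [IsProbabilityMeasure P] (hL2 : ∀ m, MemLp (fun ω => W ω m) 2 P)
    (hmean : ∀ m, ∫ ω, W ω m ∂P = 0)
    (hcov : ∀ m n, (∫ ω, W ω m * (starRingEnd ℂ) (W ω n) ∂P) = if m = n then (s : ℂ) else 0)
    (c : ℂ) (m : Fin M) :
    ∫ ω, ‖c + W ω m‖ ^ 2 ∂P = ‖c‖ ^ 2 + s := by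
  have hcW : Integrable (fun ω => c * (starRingEnd ℂ) (W ω m)) P :=
    ((hL2 m).star.integrable (by norm_num)).const_mul c
  have hcross : ∫ ω, (c * (starRingEnd ℂ) (W ω m)).re ∂P = 0 := by
    have h := integral_re (𝕜 := ℂ) hcW
    simp only [RCLike.re_eq_complex_re] at h
    rw [h, integral_const_mul, integral_conj, hmean]
    simp
  have hexp : ∀ ω, ‖c + W ω m‖ ^ 2
      = ‖c‖ ^ 2 + ‖W ω m‖ ^ 2 + 2 * (c * (starRingEnd ℂ) (W ω m)).re := by
    intro ω
    simp only [← Complex.normSq_eq_norm_sq, Complex.normSq_add]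
  simp only [hexp]
  have hsq : Integrable (fun ω => ‖W ω m‖ ^ 2) P := (hL2 m).integrable_norm_pow (by norm_num)
  have hre : Integrable (fun ω => 2 * (c * (starRingEnd ℂ) (W ω m)).re) P :=
    hcW.re.const_mul 2
  have hsum : Integrable (fun ω => ‖c‖ ^ 2 + ‖W ω m‖ ^ 2) P := (integrable_const _).add hsq
  rw [integral_add hsum hre,
    integral_add (integrable_const _) hsq, integral_const_mul, hcross,
    integral_norm_sq hcov]
  simp

theorem norm_dotc_sq (u h : Fin M → ℂ) :
    ((‖dotc u h‖ ^ 2 : ℝ) : ℂ) = ∑ m, ∑ n,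
      (starRingEnd ℂ) (h m) * h n * (u m * (starRingEnd ℂ) (u n)) := by
  push_cast
  rw [← Complex.conj_mul']
  simp only [dotc, map_sum, map_mul, Complex.conj_conj, Finset.sum_mul_sum]
  refine Finset.sum_congr rfl fun m _ => Finset.sum_congr rfl fun n _ => ?_
  ring

theorem integrable_norm_dotc_sq (hL2 : ∀ m, MemLp (fun ω => W ω m) 2 P) (h : Fin M → ℂ) :
    Integrable (fun ω => ‖dotc (W ω) h‖ ^ 2) P := by
  have hmem : MemLp (fun ω => dotc (W ω) h) 2 P :=
    memLp_finsetSum _ fun m _ => (hL2 m).star.mul_const (h m)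
  exact hmem.integrable_norm_pow (by norm_num)

theorem integral_norm_dotc_sq (hL2 : ∀ m, MemLp (fun ω => W ω m) 2 P)
    (hcov : ∀ m n, (∫ ω, W ω m * (starRingEnd ℂ) (W ω n) ∂P) = if m = n then (s : ℂ) else 0)
    (h : Fin M → ℂ) :
    ∫ ω, ‖dotc (W ω) h‖ ^ 2 ∂P = s * ∑ m, ‖h m‖ ^ 2 := by
  have key : ((∫ ω, ‖dotc (W ω) h‖ ^ 2 ∂P : ℝ) : ℂ) = ((s * ∑ m, ‖h m‖ ^ 2 : ℝ) : ℂ) := by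
    rw [← integral_complex_ofReal]
    simp only [norm_dotc_sq]
    have hint := fun m n =>
      (integrable_mul_conj hL2 m n).const_mul ((starRingEnd ℂ) (h m) * h n)
    rw [integral_finsetSum _ fun m _ => integrable_finsetSum _ fun n _ => hint m n]
    simp only [integral_finsetSum _ fun n _ => hint _ n, integral_const_mul, hcov, mul_ite,
      mul_zero, Finset.sum_ite_eq, Finset.mem_univ, if_true, Complex.conj_mul']
    push_cast
    rw [← Finset.sum_mul, mul_comm]
  exact_mod_cast key

end Noise

/-- The convex function `z ↦ log (1 + a / z)` lies above its tangent line at `m`. -/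
theorem log_one_add_div_tangent_le {a m z : ℝ} (ha : 0 ≤ a) (hm : 0 < m) (hz : 0 < z) :
    Real.log (1 + a / m) - a / (m * (m + a)) * (z - m) ≤ Real.log (1 + a / z) := by
  have hma : 0 < 1 + a / m := by positivity
  have hza : 0 < 1 + a / z := by positivity
  have hlog := Real.one_sub_inv_le_log_of_pos (div_pos hza hma)
  rw [Real.log_div hza.ne' hma.ne'] at hlog
  have hgap : 1 - ((1 + a / z) / (1 + a / m))⁻¹ + a / (m * (m + a)) * (z - m)
      = a * (z - m) ^ 2 / (m * (m + a) * (z + a)) := by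
    have : m + a ≠ 0 := by positivity
    have : z + a ≠ 0 := by positivity
    field_simp
    ring
  have : 0 ≤ a * (z - m) ^ 2 / (m * (m + a) * (z + a)) := by positivity
  linarith

/-- Jensen's inequality for the convex function `z ↦ log (1 + a / z)`. -/
theorem log_one_add_div_integral_le {Ω : Type*} [MeasurableSpace Ω] {P : Measure Ω}
    [IsProbabilityMeasure P] {a : ℝ} {Z : Ω → ℝ} (ha : 0 ≤ a) (hpos : ∀ᵐ ω ∂P, 0 < Z ω)
    (hm : 0 < ∫ ω, Z ω ∂P) (hint : Integrable Z P)
    (hlog : Integrable (fun ω => Real.log (1 + a / Z ω)) P) :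
    Real.log (1 + a / ∫ ω, Z ω ∂P) ≤ ∫ ω, Real.log (1 + a / Z ω) ∂P := by
  set m := ∫ ω, Z ω ∂P with hmdef
  have hlin : Integrable (fun ω => a / (m * (m + a)) * (Z ω - m)) P :=
    (hint.sub (integrable_const m)).const_mul _
  calc Real.log (1 + a / m)
      = ∫ ω, (Real.log (1 + a / m) - a / (m * (m + a)) * (Z ω - m)) ∂P := by
        rw [integral_sub (integrable_const _) hlin, integral_const_mul,
          integral_sub hint (integrable_const _)]
        simp [← hmdef]
    _ ≤ _ := integral_mono_ae ((integrable_const _).sub hlin) hlog <| by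
        filter_upwards [hpos] with ω hω
        exact log_one_add_div_tangent_le ha hm hω

/-- Theorem 1(b) of the paper: lower bound on the mean spectral efficiency
`E[(1/|K|) Σ_{k∈K} log(1 + |μ† h_k|² E_k / Z_k)]` of PACE-aided beamforming, under
mutually orthogonal receive array response vectors with `‖a_rx(ℓ)‖² = M_rx` and a
centered noise vector `Ŵ` with uncorrelated components of variance `N₀/D₂`. -/
theorem stmt1 {L Mtx Mrx : ℕ} (hL : 0 < L) (hMtx : 0 < Mtx) (hMrx : 0 < Mrx)
    (α : Fin L → ℂ) (arx : Fin L → Fin Mrx → ℂ) (atx : Fin L → Fin Mtx → ℂ)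
    (τhat τ : Fin L → ℝ) (fc : ℝ) (t : Fin Mtx → ℂ)
    {ι : Type*} (K : Finset ι) (hK : K.Nonempty)
    (fk : ι → ℝ) (Ek : ι → ℝ) (hEk : ∀ k ∈ K, 0 < Ek k)
    (horth : ∀ ℓ m, ℓ ≠ m → dotc (arx ℓ) (arx m) = 0)
    (hnorm : ∀ ℓ, dotc (arx ℓ) (arx ℓ) = (Mrx : ℂ))
    {Ω : Type*} [MeasureSpace Ω] [IsProbabilityMeasure (ℙ : Measure Ω)]
    (W : Ω → Fin Mrx → ℂ)
    (N0 D2 Er Tcs Ts v θbar : ℝ)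
    (hN0 : 0 < N0) (hD2 : 0 < D2) (hEr : 0 < Er)
    (hTcs : 0 < Tcs) (hTs : 0 < Ts) (hv : 0 ≤ v)
    (hWL2 : ∀ m, MemLp (fun ω => W ω m) 2 ℙ)
    (hWmean : ∀ m, (∫ ω, W ω m) = 0)
    (hWcov : ∀ m n, (∫ ω, W ω m * (starRingEnd ℂ) (W ω n))
      = if m = n then ((N0 / D2 : ℝ) : ℂ) else 0)
    (μ : Fin Mrx → ℂ)
    (hμ : μ = fun i => ((Real.sqrt Er : ℝ) : ℂ) * Complex.exp ((-θbar : ℝ) * Complex.I) *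
      ((Real.exp (-(v / 2)) : ℝ) : ℂ) * (chanMat α arx atx τhat fc).mulVec t i)
    (hvec : ι → Fin Mrx → ℂ)
    (hhvec : ∀ k ∈ K, hvec k = (chanMat α arx atx τ (fc + fk k)).mulVec t)
    (Z : ι → Ω → ℝ)
    (hZ : ∀ k ∈ K, Z k = fun ω => (∑ i, ‖μ i + W ω i‖ ^ 2) * N0 * Tcs / Ts
      + ‖dotc (W ω) (hvec k)‖ ^ 2 * Ek k)
    (hZpos : ∀ k ∈ K, ∀ᵐ ω, 0 < Z k ω)
    (hZint : ∀ k ∈ K, Integrable (Z k))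
    (hlogint : ∀ k ∈ K, Integrable (fun ω =>
      Real.log (1 + ‖dotc μ (hvec k)‖ ^ 2 * Ek k / Z k ω))) :
    (∫ ω, (1 / (K.card : ℝ)) * ∑ k ∈ K,
        Real.log (1 + ‖dotc μ (hvec k)‖ ^ 2 * Ek k / Z k ω))
      ≥ (1 / (K.card : ℝ)) * ∑ k ∈ K,
        Real.log (1 +
          Mrx * Er * Real.exp (-v) * ‖betaCoef α atx τhat τ t fc (fk k)‖ ^ 2
            * Ek k /
          (betaZero α atx t * (N0 / D2) * Ek k
            + betaZero α atx t * (N0 * Tcs / Ts) * Er * Real.exp (-v)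
            + N0 ^ 2 * Tcs / (D2 * Ts))) := by
  set c : ℂ := ((Real.sqrt Er : ℝ) : ℂ) * Complex.exp ((-θbar : ℝ) * Complex.I) *
    ((Real.exp (-(v / 2)) : ℝ) : ℂ) with hc
  have hcnorm : ‖c‖ ^ 2 = Er * Real.exp (-v) := by
    rw [hc, norm_mul, norm_mul, Complex.norm_exp_ofReal_mul_I, Complex.norm_real,
      Complex.norm_real, Real.norm_of_nonneg (Real.sqrt_nonneg _),
      Real.norm_of_nonneg (Real.exp_pos _).le, mul_one, mul_pow, Real.sq_sqrt hEr.le,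
      ← Real.exp_nat_mul]
    congr 2
    push_cast
    ring
  have hμsq : ∑ i, ‖μ i‖ ^ 2 = Er * Real.exp (-v) * (Mrx * betaZero α atx t) := by
    rw [← sum_norm_sq_chanMat_mulVec horth hnorm τhat t fc, Finset.mul_sum]
    simp only [hμ, norm_mul c, mul_pow, hcnorm]
  have hβ : 0 ≤ betaZero α atx t := Finset.sum_nonneg fun ℓ _ => by positivity
  have hMrx' : (0 : ℝ) < Mrx := by exact_mod_cast hMrx
  rw [integral_const_mul, integral_finsetSum _ hlogint, ge_iff_le]
  refine mul_le_mul_of_nonneg_left (Finset.sum_le_sum fun k hk => ?_) (by positivity)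
  have hE := hEk k hk
  set D := betaZero α atx t * (N0 / D2) * Ek k
    + betaZero α atx t * (N0 * Tcs / Ts) * Er * Real.exp (-v)
    + N0 ^ 2 * Tcs / (D2 * Ts) with hD
  have hDpos : 0 < D := by positivity
  have hmean : ∫ ω, Z k ω = Mrx * D := by
    have hsum : Integrable (fun ω => ∑ i, ‖μ i + W ω i‖ ^ 2) :=
      integrable_finsetSum _ fun i _ => integrable_norm_add_sq hWL2 (μ i) i
    rw [hZ k hk, integral_add (((hsum.mul_const N0).mul_const Tcs).div_const Ts)
        ((integrable_norm_dotc_sq hWL2 _).mul_const _),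
      integral_div, integral_mul_const, integral_mul_const, integral_mul_const,
      integral_finsetSum _ fun i _ => integrable_norm_add_sq hWL2 (μ i) i,
      integral_norm_dotc_sq hWL2 hWcov]
    simp only [integral_norm_add_sq hWL2 hWmean hWcov]
    rw [Finset.sum_add_distrib, hμsq, hhvec k hk, sum_norm_sq_chanMat_mulVec horth hnorm, hD]
    simp only [Finset.sum_const, Finset.card_univ, Fintype.card_fin, nsmul_eq_mul]
    field_simp
    ring
  have hsignal : ‖dotc μ (hvec k)‖ ^ 2
      = Er * Real.exp (-v) * (Mrx * ‖betaCoef α atx τhat τ t fc (fk k)‖) ^ 2 := by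
    rw [hμ, hhvec k hk, dotc_const_mul_left, dotc_chanMat_mulVec horth hnorm, norm_mul,
      RCLike.norm_conj, mul_pow, hcnorm, norm_mul, Complex.norm_natCast]
  have harg : Mrx * Er * Real.exp (-v) * ‖betaCoef α atx τhat τ t fc (fk k)‖ ^ 2 * Ek k / D
      = ‖dotc μ (hvec k)‖ ^ 2 * Ek k / ∫ ω, Z k ω := by
    rw [hmean, hsignal]
    field_simp
  rw [harg]
  exact log_one_add_div_integral_le (by positivity) (hZpos k hk)
    (by rw [hmean]; positivity) (hZint k hk) (hlogint k hk)
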